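/- The von Mises consistent tangent is symmetric positive definite: for ε ∈ Sym(3) with |s^tr(ε)| > Y, the linear map L : Sym(3) → Sym(3), L(h) = ℂh − (4G²/(2G + a))·dev(h) + (4G²/(2G + a))·(Y/|s^tr(ε)|)·(dev(h) − (n^tr(ε) : h)·n^tr(ε)), is symmetric with respect to the Frobenius inner product (L(h₁) : h₂ = h₁ : L(h₂) for all h₁, h₂) and positive definite (L(h) : h > 0 for all h ≠ 0). -/

import Mathlib

open Matrix

/-- Frobenius inner product on 3×3 real matrices. -/
noncomputable def frob (σ τ : Matrix (Fin 3) (Fin 3) ℝ) : ℝ := ∑ i, ∑ j, σ i j * τ i j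

/-- Frobenius norm. -/
noncomputable def fnorm (τ : Matrix (Fin 3) (Fin 3) ℝ) : ℝ := Real.sqrt (frob τ τ)

/-- Deviatoric part. -/
noncomputable def devM (τ : Matrix (Fin 3) (Fin 3) ℝ) : Matrix (Fin 3) (Fin 3) ℝ :=
  τ - (Matrix.trace τ / 3) • (1 : Matrix (Fin 3) (Fin 3) ℝ)

/-- The isotropic elasticity tensor `ℂε = K tr(ε) I + 2G dev(ε)`. -/
noncomputable def Celast (K G : ℝ) (ε : Matrix (Fin 3) (Fin 3) ℝ) : Matrix (Fin 3) (Fin 3) ℝ :=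
  (K * Matrix.trace ε) • (1 : Matrix (Fin 3) (Fin 3) ℝ) + (2 * G) • devM ε

/-- Trial deviatoric stress `s^tr(ε) = dev(ℂ(ε − εₖ₋₁ᵖ)) − βₖ₋₁`. -/
noncomputable def strVM (K G : ℝ) (εp βp ε : Matrix (Fin 3) (Fin 3) ℝ) :
    Matrix (Fin 3) (Fin 3) ℝ :=
  devM (Celast K G (ε - εp)) - βp

/-- Normalized trial flow direction `n^tr(ε) = s^tr(ε)/|s^tr(ε)|`. -/
noncomputable def ntrVM (K G : ℝ) (εp βp ε : Matrix (Fin 3) (Fin 3) ℝ) :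
    Matrix (Fin 3) (Fin 3) ℝ :=
  (fnorm (strVM K G εp βp ε))⁻¹ • strVM K G εp βp ε

/-- The von Mises consistent tangent operator as a map on matrices. -/
noncomputable def LVM (K G a Y : ℝ) (εp βp ε h : Matrix (Fin 3) (Fin 3) ℝ) :
    Matrix (Fin 3) (Fin 3) ℝ :=
  Celast K G h - (4 * G ^ 2 / (2 * G + a)) • devM h +
    (4 * G ^ 2 / (2 * G + a) * (Y / fnorm (strVM K G εp βp ε))) •
      (devM h - frob (ntrVM K G εp βp ε) h • ntrVM K G εp βp ε)

theorem frob_eq_sum (σ τ : Matrix (Fin 3) (Fin 3) ℝ) :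
    frob σ τ = ∑ p : Fin 3 × Fin 3, σ p.1 p.2 * τ p.1 p.2 := by
  rw [frob, Fintype.sum_prod_type]

theorem frob_comm (σ τ : Matrix (Fin 3) (Fin 3) ℝ) : frob σ τ = frob τ σ := by
  simp only [frob, mul_comm]

theorem frob_add_left (σ τ υ : Matrix (Fin 3) (Fin 3) ℝ) :
    frob (σ + τ) υ = frob σ υ + frob τ υ := by
  simp only [frob, Matrix.add_apply, add_mul, Finset.sum_add_distrib]

theorem frob_sub_left (σ τ υ : Matrix (Fin 3) (Fin 3) ℝ) :
    frob (σ - τ) υ = frob σ υ - frob τ υ := by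
  simp only [frob, Matrix.sub_apply, sub_mul, Finset.sum_sub_distrib]

theorem frob_smul_left (c : ℝ) (σ τ : Matrix (Fin 3) (Fin 3) ℝ) :
    frob (c • σ) τ = c * frob σ τ := by
  simp only [frob, Matrix.smul_apply, smul_eq_mul, mul_assoc, Finset.mul_sum]

theorem frob_one_left (τ : Matrix (Fin 3) (Fin 3) ℝ) : frob 1 τ = Matrix.trace τ := by
  simp [frob, Matrix.one_apply, Matrix.trace]

theorem frob_self_nonneg (τ : Matrix (Fin 3) (Fin 3) ℝ) : 0 ≤ frob τ τ :=
  Finset.sum_nonneg fun _ _ => Finset.sum_nonneg fun _ _ => mul_self_nonneg _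

theorem frob_self_eq_zero {τ : Matrix (Fin 3) (Fin 3) ℝ} : frob τ τ = 0 ↔ τ = 0 := by
  rw [frob_eq_sum, Finset.sum_eq_zero_iff_of_nonneg fun _ _ => mul_self_nonneg _]
  simp [← Matrix.ext_iff]

theorem frob_sq_le (σ τ : Matrix (Fin 3) (Fin 3) ℝ) :
    frob σ τ ^ 2 ≤ frob σ σ * frob τ τ := by
  simp only [frob_eq_sum, ← pow_two]
  exact Finset.sum_mul_sq_le_sq_mul_sq _ _ _

theorem trace_devM (τ : Matrix (Fin 3) (Fin 3) ℝ) : Matrix.trace (devM τ) = 0 := by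
  simp [devM, Matrix.trace_sub, Matrix.trace_smul]

theorem frob_devM_right_of_trace_eq_zero {σ : Matrix (Fin 3) (Fin 3) ℝ}
    (hσ : Matrix.trace σ = 0) (τ : Matrix (Fin 3) (Fin 3) ℝ) :
    frob σ (devM τ) = frob σ τ := by
  rw [frob_comm, devM, frob_sub_left, frob_smul_left, frob_one_left, hσ, frob_comm σ]
  ring

theorem trace_strVM (K G : ℝ) {βp : Matrix (Fin 3) (Fin 3) ℝ} (hβtr : Matrix.trace βp = 0)
    (εp ε : Matrix (Fin 3) (Fin 3) ℝ) : Matrix.trace (strVM K G εp βp ε) = 0 := by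
  rw [strVM, Matrix.trace_sub, trace_devM, hβtr, sub_zero]

theorem trace_ntrVM (K G : ℝ) {βp : Matrix (Fin 3) (Fin 3) ℝ} (hβtr : Matrix.trace βp = 0)
    (εp ε : Matrix (Fin 3) (Fin 3) ℝ) : Matrix.trace (ntrVM K G εp βp ε) = 0 := by
  rw [ntrVM, Matrix.trace_smul, trace_strVM K G hβtr, smul_zero]

theorem frob_ntrVM_self {K G : ℝ} {εp βp ε : Matrix (Fin 3) (Fin 3) ℝ}
    (hs : fnorm (strVM K G εp βp ε) ≠ 0) :
    frob (ntrVM K G εp βp ε) (ntrVM K G εp βp ε) = 1 := by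
  have h : frob (strVM K G εp βp ε) (strVM K G εp βp ε) = fnorm (strVM K G εp βp ε) ^ 2 :=
    (Real.sq_sqrt (frob_self_nonneg _)).symm
  rw [ntrVM, frob_smul_left, frob_comm, frob_smul_left, h]
  field_simp

/-- The bilinear form of the consistent tangent, split into its volumetric, deviatoric and
flow-direction contributions. -/
theorem frob_LVM (K G a Y : ℝ) (εp βp ε h k : Matrix (Fin 3) (Fin 3) ℝ) :
    frob (LVM K G a Y εp βp ε h) k =
      K * (Matrix.trace h * Matrix.trace k) +
        (2 * G - 4 * G ^ 2 / (2 * G + a)) * frob (devM h) (devM k) +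
        4 * G ^ 2 / (2 * G + a) * (Y / fnorm (strVM K G εp βp ε)) *
          (frob (devM h) (devM k) -
            frob (ntrVM K G εp βp ε) h * frob (ntrVM K G εp βp ε) k) := by
  rw [frob_devM_right_of_trace_eq_zero (trace_devM h)]
  simp only [LVM, Celast, frob_add_left, frob_sub_left, frob_smul_left, frob_one_left]
  ring

/-- The von Mises consistent tangent is symmetric with respect to the Frobenius inner
product and positive definite on `Sym(3)`. -/
theorem vonMises_tangent_symm_posdef (K G a Y : ℝ) (hK : 0 < K) (hG : 0 < G) (ha : 0 < a)
    (hY : 0 < Y) (εp βp : Matrix (Fin 3) (Fin 3) ℝ) (hεp : εp.IsSymm) (hβp : βp.IsSymm)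
    (hβtr : Matrix.trace βp = 0) (ε : Matrix (Fin 3) (Fin 3) ℝ) (hε : ε.IsSymm)
    (hplastic : Y < fnorm (strVM K G εp βp ε)) :
    (∀ h₁ h₂ : Matrix (Fin 3) (Fin 3) ℝ, h₁.IsSymm → h₂.IsSymm →
      frob (LVM K G a Y εp βp ε h₁) h₂ = frob h₁ (LVM K G a Y εp βp ε h₂)) ∧
    (∀ h : Matrix (Fin 3) (Fin 3) ℝ, h.IsSymm → h ≠ 0 →
      0 < frob (LVM K G a Y εp βp ε h) h) := by
  refine ⟨fun h₁ h₂ _ _ => ?_, fun h _ hh => ?_⟩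
  · rw [frob_comm h₁, frob_LVM, frob_LVM, frob_comm (devM h₂)]
    ring
  · have hs : 0 < fnorm (strVM K G εp βp ε) := hY.trans hplastic
    have hflow : 0 ≤ frob (devM h) (devM h) -
        frob (ntrVM K G εp βp ε) h * frob (ntrVM K G εp βp ε) h := by
      have hcs := frob_sq_le (ntrVM K G εp βp ε) (devM h)
      rw [frob_ntrVM_self hs.ne',
        frob_devM_right_of_trace_eq_zero (trace_ntrVM K G hβtr εp ε)] at hcs
      linarith
    have hmod : 0 < 2 * G - 4 * G ^ 2 / (2 * G + a) := by
      have : 2 * G - 4 * G ^ 2 / (2 * G + a) = 2 * G * a / (2 * G + a) := by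
        field_simp
        ring
      rw [this]
      positivity
    have hdev := frob_self_nonneg (devM h)
    have hvol := mul_self_nonneg (Matrix.trace h)
    have helast : 0 < K * (Matrix.trace h * Matrix.trace h) +
        (2 * G - 4 * G ^ 2 / (2 * G + a)) * frob (devM h) (devM h) := by
      rcases hdev.eq_or_lt with hd | hd
      · have htr : Matrix.trace h ≠ 0 := fun ht => hh <| by
          simpa [devM, ht] using frob_self_eq_zero.mp hd.symm
        have := mul_self_pos.mpr htr
        positivity
      · positivity
    rw [frob_LVM]
    positivity
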